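/- arXiv:2012.05880 — 2 statements merged into one kernel-verified Lean document; each statement's English description precedes it below -/
import Mathlib

section
/- Let d ≥ 2 and 1 ≤ i ≤ d−1. For g ∈ O_d(ℂ), the setwise image g·L_d^{(i)} := {(g v, g M gᵀ) : (v,M) ∈ L_d^{(i)}} equals L_d^{(i)} if and only if g is block diagonal of the form diag(B, D) where B ∈ O_{d−i}(ℂ) is the top-left (d−i)×(d−i) block and D is an i×i diagonal matrix with diagonal entries in {−1, 1}. (The normalizer of the subspace L_d^{(i)} in O_d(ℂ) is N_d^{d−i}(ℂ).) -/
open Matrix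

/-- The linear subspace `L_d^{(i)} ⊆ ℂ^d ⊕ so(d,ℂ)`: pairs `(v, M)` with `M`
skew-symmetric, `v_j = 0` for all `j` except the last coordinate, and `M_{j,k} = 0`
whenever `d − i + 2 ≤ k ≤ d` and `1 ≤ j ≤ k − 2` (1-based), i.e. in 0-based indices
`d − i + 1 ≤ k` and `j + 1 < k`. -/
def Lset (d i : ℕ) : Set ((Fin d → ℂ) × Matrix (Fin d) (Fin d) ℂ) :=
  {p | p.2ᵀ = -p.2 ∧
    (∀ j : Fin d, (j : ℕ) + 1 < d → p.1 j = 0) ∧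
    (∀ j k : Fin d, d - i + 1 ≤ (k : ℕ) → (j : ℕ) + 1 < (k : ℕ) → p.2 j k = 0)}

lemma aux_maps {d : ℕ} (i : ℕ) (g : Matrix (Fin d) (Fin d) ℂ) (hi1 : 1 ≤ i)
    (h : ∀ j k : Fin d, j ≠ k → (d - i ≤ (j : ℕ) ∨ d - i ≤ (k : ℕ)) → g j k = 0)
    (p : (Fin d → ℂ) × Matrix (Fin d) (Fin d) ℂ) (hp : p ∈ Lset d i) :
    (g.mulVec p.1, g * p.2 * gᵀ) ∈ Lset d i := by
  obtain ⟨h1, h2, h3⟩ := hp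
  refine ⟨?_, ?_, ?_⟩
  · simp [Matrix.transpose_mul, h1, Matrix.mul_assoc]
  · intro j hj
    simp only [Matrix.mulVec, dotProduct]
    refine Finset.sum_eq_zero fun a _ => ?_
    by_cases ha : (a : ℕ) + 1 < d
    · rw [h2 a ha, mul_zero]
    · have hne : j ≠ a := by rintro rfl; exact ha hj
      rw [h j a hne (Or.inr (by omega)), zero_mul]
  · intro j k hk hjk
    simp only [Matrix.mul_apply, Matrix.transpose_apply]
    refine Finset.sum_eq_zero fun b _ => ?_
    by_cases hb : k = b
    · subst hb
      rw [Finset.sum_eq_zero, zero_mul]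
      intro a _
      by_cases ha : (a : ℕ) + 1 < k
      · rw [h3 a k hk ha, mul_zero]
      · have hne : j ≠ a := by rintro rfl; exact ha hjk
        rw [h j a hne (Or.inr (by omega)), zero_mul]
    · rw [h k b hb (Or.inl (by omega)), mul_zero]

lemma aux_row {d : ℕ} (g : Matrix (Fin d) (Fin d) ℂ) (hg : gᵀ * g = 1) (k : Fin d)
    (h : ∀ j, j ≠ k → g j k = 0) : ∀ j, j ≠ k → g k j = 0 := by
  have key : ∀ a, (gᵀ * g) a k = g k a * g k k := by
    intro a
    simp only [Matrix.mul_apply, Matrix.transpose_apply]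
    refine Finset.sum_eq_single k (fun b _ hb => ?_) (by simp)
    rw [h b hb, mul_zero]
  intro j hj
  have h1 := key k
  have h2 := key j
  rw [hg] at h1 h2
  rw [Matrix.one_apply_eq] at h1
  rw [Matrix.one_apply_ne hj] at h2
  rcases mul_eq_zero.mp h2.symm with h3 | h3
  · exact h3
  · rw [h3] at h1
    simp at h1

lemma aux_diag {d : ℕ} (g : Matrix (Fin d) (Fin d) ℂ) (hg : gᵀ * g = 1) (k : Fin d)
    (h : ∀ j, j ≠ k → g j k = 0) : g k k = 1 ∨ g k k = -1 := by
  have h1 : (gᵀ * g) k k = g k k * g k k := by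
    simp only [Matrix.mul_apply, Matrix.transpose_apply]
    refine Finset.sum_eq_single k (fun b _ hb => ?_) (by simp)
    rw [h b hb, mul_zero]
  rw [hg, Matrix.one_apply_eq] at h1
  exact mul_self_eq_one_iff.mp h1.symm

lemma aux_col {d : ℕ} (i : ℕ) (hi1 : 1 ≤ i)
    (g : Matrix (Fin d) (Fin d) ℂ) (hg : gᵀ * g = 1)
    (H : ∀ p ∈ Lset d i, (g.mulVec p.1, g * p.2 * gᵀ) ∈ Lset d i) (n : ℕ) :
    ∀ k : Fin d, (k : ℕ) + n + 1 = d → d - i ≤ (k : ℕ) → ∀ j, j ≠ k → g j k = 0 := by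
  induction n using Nat.strong_induction_on with
  | _ n ih =>
  intro k hkn hk j hj
  have hjk : (j : ℕ) ≠ k := fun h => hj (Fin.ext h)
  by_cases hlt : (k : ℕ) < j
  · exact aux_row g hg j (ih (d - 1 - j) (by omega) j (by omega) (by omega)) k (Ne.symm hj)
  · rcases Nat.eq_zero_or_pos n with hn | hn
    · have hm : ((Pi.single k 1, 0) : (Fin d → ℂ) × Matrix (Fin d) (Fin d) ℂ) ∈ Lset d i := by
        refine ⟨by simp, ?_, by simp⟩
        intro a ha
        have : a ≠ k := by rintro rfl; omega
        simp [this]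
      have := (H _ hm).2.1 j (by omega)
      simpa using this
    · obtain ⟨l, hl⟩ : ∃ l : Fin d, (l : ℕ) = k + 1 := ⟨⟨k + 1, by omega⟩, rfl⟩
      have hlk : k ≠ l := by rintro rfl; omega
      have hcol := ih (n - 1) (by omega) l (by omega) (by omega)
      have hrow := aux_row g hg l hcol
      have hm : ((0, Matrix.single k l 1 - Matrix.single l k 1) :
          (Fin d → ℂ) × Matrix (Fin d) (Fin d) ℂ) ∈ Lset d i := by
        refine ⟨by simp, by simp, ?_⟩
        intro a b hb hab
        have e1 : ¬ (k = a ∧ l = b) := by rintro ⟨rfl, rfl⟩; omega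
        have e2 : ¬ (l = a ∧ k = b) := by rintro ⟨rfl, rfl⟩; omega
        simp [Matrix.single_apply, e1, e2]
      have h0 := (H _ hm).2.2 j l (by omega) (by omega)
      have h1 : (g * (Matrix.single k l 1 - Matrix.single l k 1 : Matrix (Fin d) (Fin d) ℂ) * gᵀ) j l
          = g j k * g l l - g j l * g l k := by
        simp [Matrix.mul_sub, Matrix.sub_mul, Matrix.mul_apply, Matrix.single_apply,
          ite_and, Finset.sum_ite_eq, sub_mul]
      have h2 : g j k * g l l - g j l * g l k = 0 := h1.symm.trans h0
      rw [hrow k hlk, mul_zero, sub_zero] at h2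
      rcases mul_eq_zero.mp h2 with h3 | h3
      · exact h3
      · rcases aux_diag g hg l hcol with h4 | h4 <;> rw [h3] at h4 <;> simp at h4

/-- the normalizer of `L_d^{(i)}` in `O_d(ℂ)` is `N_d^{d−i}(ℂ)`: for
`g ∈ O_d(ℂ)`, the setwise image `g · L_d^{(i)}` equals `L_d^{(i)}` iff `g` is block
diagonal `diag(B, D)` with `B` the top-left `(d−i)×(d−i)` block and `D` an `i×i`
diagonal matrix with entries `±1` — i.e. every entry of `g` in the last `i` rows or
columns is zero off the diagonal and `±1` on the diagonal. (`B ∈ O_{d−i}(ℂ)` then holds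
automatically since `g` is orthogonal.) -/
theorem stmt9 {d : ℕ} (hd : 2 ≤ d) (i : ℕ) (hi1 : 1 ≤ i) (hi2 : i ≤ d - 1)
    (g : Matrix (Fin d) (Fin d) ℂ) (hg : g * gᵀ = 1) :
    ((fun p : (Fin d → ℂ) × Matrix (Fin d) (Fin d) ℂ =>
        (g.mulVec p.1, g * p.2 * gᵀ)) '' Lset d i = Lset d i) ↔
      ((∀ j k : Fin d, j ≠ k → (d - i ≤ (j : ℕ) ∨ d - i ≤ (k : ℕ)) → g j k = 0) ∧
       (∀ j : Fin d, d - i ≤ (j : ℕ) → g j j = 1 ∨ g j j = -1)) := by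
  have hg' : gᵀ * g = 1 := mul_eq_one_comm.mp hg
  constructor
  · intro h
    have H : ∀ p ∈ Lset d i, (g.mulVec p.1, g * p.2 * gᵀ) ∈ Lset d i := by
      intro p hp
      rw [← h]
      exact ⟨p, hp, rfl⟩
    have hcol : ∀ k : Fin d, d - i ≤ (k : ℕ) → ∀ j, j ≠ k → g j k = 0 := fun k hk =>
      aux_col i hi1 g hg' H (d - 1 - k) k (by omega) hk
    refine ⟨?_, fun j hj => aux_diag g hg' j (hcol j hj)⟩
    rintro j k hjk (hj | hk)
    · exact aux_row g hg' j (hcol j hj) k hjk.symm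
    · exact hcol k hk j hjk
  · rintro ⟨h, -⟩
    apply Set.Subset.antisymm
    · rintro _ ⟨p, hp, rfl⟩
      exact aux_maps i g hi1 h p hp
    · intro p hp
      refine ⟨_, aux_maps i gᵀ hi1 (fun j k hjk ho => h k j hjk.symm ho.symm) p hp, ?_⟩
      have e : g * (gᵀ * p.2 * gᵀᵀ) * gᵀ = p.2 := by
        calc g * (gᵀ * p.2 * gᵀᵀ) * gᵀ = (g * gᵀ) * p.2 * (g * gᵀ) := by
              simp only [Matrix.transpose_transpose, Matrix.mul_assoc]
          _ = p.2 := by rw [hg, Matrix.one_mul, Matrix.mul_one]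
      refine Prod.ext ?_ e
      simp [Matrix.mulVec_mulVec, hg]
end

section
/- Let N ≥ 1 and let ι: ℝ(x₁,…,x_N) → ℂ(x₁,…,x_N) be the field embedding of the field of real rational functions in N variables into the field of complex rational functions in N variables, induced by the coefficient inclusion ℝ ↪ ℂ. Let f, I₁,…,I_s ∈ ℝ(x₁,…,x_N). If ι(f) lies in the subfield of ℂ(x₁,…,x_N) generated by the constants ℂ together with ι(I₁),…,ι(I_s), then f lies in the subfield of ℝ(x₁,…,x_N) generated by the constants ℝ together with I₁,…,I_s. (Field-theoretic content of the corollary: a set of real rational invariants that generates the complex invariant field also generates the real invariant field.) -/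
/-- Independence of `1` and `i` over the image of the real rational functions. -/
lemma indep_aux (N : ℕ)
    (ι : FractionRing (MvPolynomial (Fin N) ℝ) →+*
      FractionRing (MvPolynomial (Fin N) ℂ))
    (hι : ∀ p : MvPolynomial (Fin N) ℝ,
      ι (algebraMap (MvPolynomial (Fin N) ℝ) (FractionRing (MvPolynomial (Fin N) ℝ)) p)
        = algebraMap (MvPolynomial (Fin N) ℂ) (FractionRing (MvPolynomial (Fin N) ℂ))
            (MvPolynomial.map (algebraMap ℝ ℂ) p))
    (a b : FractionRing (MvPolynomial (Fin N) ℝ))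
    (h : ι a + algebraMap (MvPolynomial (Fin N) ℂ) (FractionRing (MvPolynomial (Fin N) ℂ))
      (MvPolynomial.C Complex.I) * ι b = 0) : a = 0 ∧ b = 0 := by
  obtain ⟨d, hd⟩ := IsLocalization.exist_integer_multiples_of_finset
    (nonZeroDivisors (MvPolynomial (Fin N) ℝ)) {a, b}
  obtain ⟨p, hp⟩ := hd a (by simp)
  obtain ⟨q, hq⟩ := hd b (by simp)
  rw [Algebra.smul_def] at hp hq
  have hd0 : algebraMap (MvPolynomial (Fin N) ℝ) (FractionRing (MvPolynomial (Fin N) ℝ)) d ≠ 0 :=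
    IsFractionRing.to_map_ne_zero_of_mem_nonZeroDivisors d.2
  have key : MvPolynomial.map (algebraMap ℝ ℂ) p
      + MvPolynomial.C Complex.I * MvPolynomial.map (algebraMap ℝ ℂ) q = 0 := by
    apply IsFractionRing.injective (MvPolynomial (Fin N) ℂ) (FractionRing (MvPolynomial (Fin N) ℂ))
    rw [map_add, map_mul, ← hι, ← hι, hp, hq, map_mul, map_mul, map_zero]
    linear_combination (ι (algebraMap _ _ (d : MvPolynomial (Fin N) ℝ))) * h
  have hpq : ∀ m, p.coeff m = 0 ∧ q.coeff m = 0 := by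
    intro m
    have := congrArg (MvPolynomial.coeff m) key
    simp only [MvPolynomial.coeff_add, MvPolynomial.coeff_C_mul, MvPolynomial.coeff_map,
      MvPolynomial.coeff_zero] at this
    have h1 := congrArg Complex.re this
    have h2 := congrArg Complex.im this
    simp at h1 h2
    exact ⟨h1, h2⟩
  have hp0 : p = 0 := MvPolynomial.ext _ _ (fun m => by simpa using (hpq m).1)
  have hq0 : q = 0 := MvPolynomial.ext _ _ (fun m => by simpa using (hpq m).2)
  rw [hp0, map_zero] at hp
  rw [hq0, map_zero] at hq
  exact ⟨(mul_eq_zero.mp hp.symm).resolve_left hd0, (mul_eq_zero.mp hq.symm).resolve_left hd0⟩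

/-- a set of real rational invariants that generates the complex
invariant field also generates the real invariant field. Concretely: let `ι` be the
field embedding `ℝ(x₁,…,x_N) → ℂ(x₁,…,x_N)` induced by the inclusion of coefficients
`ℝ ↪ ℂ` (characterized by its values on polynomials). If `ι f` lies in the subfield of
`ℂ(x₁,…,x_N)` generated by the constants `ℂ` together with `ι I₁, …, ι I_s`, then `f`
lies in the subfield of `ℝ(x₁,…,x_N)` generated by the constants `ℝ` together with
`I₁, …, I_s`. -/
theorem stmt18 (N : ℕ) (hN : 1 ≤ N)
    (ι : FractionRing (MvPolynomial (Fin N) ℝ) →+*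
      FractionRing (MvPolynomial (Fin N) ℂ))
    (hι : ∀ p : MvPolynomial (Fin N) ℝ,
      ι (algebraMap (MvPolynomial (Fin N) ℝ) (FractionRing (MvPolynomial (Fin N) ℝ)) p)
        = algebraMap (MvPolynomial (Fin N) ℂ) (FractionRing (MvPolynomial (Fin N) ℂ))
            (MvPolynomial.map (algebraMap ℝ ℂ) p))
    (s : ℕ) (I : Fin s → FractionRing (MvPolynomial (Fin N) ℝ))
    (f : FractionRing (MvPolynomial (Fin N) ℝ))
    (hf : ι f ∈ Subfield.closure
      (Set.range (fun c : ℂ =>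
          algebraMap (MvPolynomial (Fin N) ℂ) (FractionRing (MvPolynomial (Fin N) ℂ))
            (MvPolynomial.C c)) ∪
        Set.range (fun i : Fin s => ι (I i)))) :
    f ∈ Subfield.closure
      (Set.range (fun c : ℝ =>
          algebraMap (MvPolynomial (Fin N) ℝ) (FractionRing (MvPolynomial (Fin N) ℝ))
            (MvPolynomial.C c)) ∪
        Set.range I) := by
  have hind := indep_aux N ι hι
  set J := algebraMap (MvPolynomial (Fin N) ℂ) (FractionRing (MvPolynomial (Fin N) ℂ))
      (MvPolynomial.C Complex.I) with hJ
  have hJJ : J * J = -1 := by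
    rw [hJ, ← map_mul, ← MvPolynomial.C_mul, Complex.I_mul_I]
    simp
  set K := Subfield.closure
      (Set.range (fun c : ℝ =>
          algebraMap (MvPolynomial (Fin N) ℝ) (FractionRing (MvPolynomial (Fin N) ℝ))
            (MvPolynomial.C c)) ∪
        Set.range I) with hK
  have main : ∃ a ∈ K, ∃ b ∈ K, ι f = ι a + J * ι b := by
    generalize ι f = z at hf
    induction hf using Subfield.closure_induction with
    | mem x hx =>
      rcases hx with ⟨c, rfl⟩ | ⟨i, rfl⟩
      · refine ⟨_, Subfield.subset_closure (Or.inl ⟨c.re, rfl⟩),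
          _, Subfield.subset_closure (Or.inl ⟨c.im, rfl⟩), ?_⟩
        simp only [hι, MvPolynomial.map_C, hJ]
        rw [← map_mul, ← map_add, ← MvPolynomial.C_mul, ← MvPolynomial.C_add]
        congr 2
        rw [mul_comm]
        exact (Complex.re_add_im c).symm
      · exact ⟨I i, Subfield.subset_closure (Or.inr ⟨i, rfl⟩), 0, K.zero_mem, by simp⟩
    | one => exact ⟨1, K.one_mem, 0, K.zero_mem, by simp⟩
    | add x y _ _ hx hy =>
      obtain ⟨a, ha, b, hb, rfl⟩ := hx
      obtain ⟨c, hc, d, hd, rfl⟩ := hy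
      exact ⟨a + c, K.add_mem ha hc, b + d, K.add_mem hb hd, by simp only [map_add]; ring⟩
    | neg x _ hx =>
      obtain ⟨a, ha, b, hb, rfl⟩ := hx
      exact ⟨-a, K.neg_mem ha, -b, K.neg_mem hb, by simp only [map_neg]; ring⟩
    | mul x y _ _ hx hy =>
      obtain ⟨a, ha, b, hb, rfl⟩ := hx
      obtain ⟨c, hc, d, hd, rfl⟩ := hy
      refine ⟨a * c - b * d, K.sub_mem (K.mul_mem ha hc) (K.mul_mem hb hd),
        a * d + b * c, K.add_mem (K.mul_mem ha hd) (K.mul_mem hb hc), ?_⟩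
      simp only [map_add, map_sub, map_mul]
      linear_combination (ι b * ι d) * hJJ
    | inv x _ hx =>
      obtain ⟨a, ha, b, hb, rfl⟩ := hx
      by_cases h0 : ι a + J * ι b = 0
      · exact ⟨0, K.zero_mem, 0, K.zero_mem, by simp [h0]⟩
      · have h1 : ι a + J * ι (-b) ≠ 0 := by
          intro h
          obtain ⟨rfl, hb0⟩ := hind _ _ h
          rw [neg_eq_zero] at hb0
          subst hb0
          simp at h0
        have hprod : (ι a + J * ι b) * (ι a + J * ι (-b)) = ι (a * a + b * b) := by
          simp only [map_add, map_mul, map_neg]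
          linear_combination (-(ι b * ι b)) * hJJ
        have hn : ι (a * a + b * b) ≠ 0 := hprod ▸ mul_ne_zero h0 h1
        have hm : a * a + b * b ∈ K := K.add_mem (K.mul_mem ha ha) (K.mul_mem hb hb)
        refine ⟨a / (a * a + b * b), K.div_mem ha hm,
          -b / (a * a + b * b), K.div_mem (K.neg_mem hb) hm, ?_⟩
        rw [map_div₀, map_div₀, ← mul_div_assoc, ← add_div, eq_div_iff hn, ← hprod,
          inv_mul_cancel_left₀ h0]
  obtain ⟨a, ha, b, hb, h⟩ := main
  have := (hind (a - f) b (by rw [map_sub]; linear_combination -h)).1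
  rw [sub_eq_zero] at this
  exact this ▸ ha
end
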